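/- Let p ≥ 2, k ≥ 1, j ≥ 1 and m ≥ 4 be integers, and let π : ℤ/p^{k·2^{j}}ℤ → ℤ/p^{k}ℤ be the natural quotient homomorphism. Then there exists a continuous map ψ : (ℤ/p^{k·2^{j}}ℤ)^{*(m+j)} → (ℤ/p^{k}ℤ)^{*m} such that ψ(ξ + c) = ψ(ξ) + π(c) for every ξ ∈ (ℤ/p^{k·2^{j}}ℤ)^{*(m+j)} and every c ∈ ℤ/p^{k·2^{j}}ℤ, where + denotes the diagonal action. -/

import Mathlib

noncomputable section

/-- The equivalence relation defining the join `G^{*m}`: pairs `(t, g)` in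
`Δ_{m-1} × G^m` are identified iff the simplex coordinates agree and the group
coordinates agree at every index where the simplex coordinate is nonzero. -/
def JoinRel (G : Type*) [TopologicalSpace G] (m : ℕ) :
    (stdSimplex ℝ (Fin m) × (Fin m → G)) → (stdSimplex ℝ (Fin m) × (Fin m → G)) → Prop :=
  fun p q => p.1 = q.1 ∧ ∀ i, (p.1 : Fin m → ℝ) i ≠ 0 → p.2 i = q.2 i

/-- The `m`-fold join `G^{*m}`, with the quotient topology. -/
def Join (G : Type*) [TopologicalSpace G] (m : ℕ) : Type _ :=
  Quot (JoinRel G m)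

instance (G : Type*) [TopologicalSpace G] (m : ℕ) : TopologicalSpace (Join G m) :=
  inferInstanceAs (TopologicalSpace (Quot (JoinRel G m)))

/-- The diagonal action of `G` (written additively) on the join `G^{*m}`. -/
def Join.addAct {G : Type*} [TopologicalSpace G] [AddGroup G] {m : ℕ}
    (ξ : Join G m) (c : G) : Join G m :=
  Quot.map (fun p => (p.1, fun i => p.2 i + c))
    (fun _ _ h => ⟨h.1, fun i hi => by simp [h.2 i hi]⟩) ξ

/-- The positive part of `Re (χ(-h) u) - |u| cos (π / n)`, whose support is the open arc of angular
radius `π / n` around the root of unity `χ(h)`. -/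
def arc (n : ℕ) [NeZero n] (u : ℂ) (h : ZMod n) : ℝ :=
  max 0 ((ZMod.stdAddChar (-h) * u).re - ‖u‖ * Real.cos (Real.pi / n))

lemma continuous_arc (n : ℕ) [NeZero n] (h : ZMod n) : Continuous fun u => arc n u h := by
  unfold arc
  fun_prop

lemma arc_nonneg (n : ℕ) [NeZero n] (u : ℂ) (h : ZMod n) : 0 ≤ arc n u h := le_max_left _ _

lemma arc_ne_zero_iff (n : ℕ) [NeZero n] (u : ℂ) (h : ZMod n) :
    arc n u h ≠ 0 ↔ ‖u‖ * Real.cos (Real.pi / n) < (ZMod.stdAddChar (-h) * u).re := by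
  rw [← (arc_nonneg n u h).lt_iff_ne']
  rw [arc, lt_max_iff, sub_pos]
  simp only [lt_irrefl, false_or]

lemma norm_stdAddChar (n : ℕ) [NeZero n] (c : ZMod n) : ‖ZMod.stdAddChar c‖ = 1 := by
  rw [ZMod.stdAddChar_apply]
  exact Circle.norm_coe _

lemma arc_mul (n : ℕ) [NeZero n] (u : ℂ) (h c : ZMod n) :
    arc n (ZMod.stdAddChar c * u) (h + c) = arc n u h := by
  have : ZMod.stdAddChar (-(h + c)) * (ZMod.stdAddChar c * u) = ZMod.stdAddChar (-h) * u := by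
    rw [← mul_assoc, ← AddChar.map_add_eq_mul]
    congr 3
    ring
  simp only [arc, this, norm_mul, norm_stdAddChar, one_mul]

lemma re_stdAddChar_mul (n : ℕ) [NeZero n] (k : ℤ) (r θ : ℝ) :
    (ZMod.stdAddChar (-(k : ZMod n)) * (r * Complex.exp (θ * Complex.I))).re =
      r * Real.cos (θ - 2 * Real.pi * k / n) := by
  have : ZMod.stdAddChar (-(k : ZMod n)) * (r * Complex.exp (θ * Complex.I)) =
      r * Complex.exp ((θ - 2 * Real.pi * k / n : ℝ) * Complex.I) := by
    rw [← Int.cast_neg, ZMod.stdAddChar_coe, mul_left_comm, ← Complex.exp_add]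
    congr 2
    push_cast
    ring
  rw [this, Complex.re_ofReal_mul, Complex.exp_ofReal_mul_I_re]

lemma exists_int_abs_sub_lt_of_cos_lt {x y : ℝ} (hy : 0 ≤ y) (h : Real.cos y < Real.cos x) :
    ∃ k : ℤ, |x - 2 * Real.pi * k| < y := by
  have hp := Real.pi_pos
  refine ⟨round (x / (2 * Real.pi)), ?_⟩
  set k := round (x / (2 * Real.pi))
  have h1 : |x - 2 * Real.pi * k| ≤ Real.pi := by
    have h2 := abs_sub_round (x / (2 * Real.pi))
    have : x - 2 * Real.pi * k = (2 * Real.pi) * (x / (2 * Real.pi) - k) := by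
      field_simp
    rw [this, abs_mul, abs_of_pos (by positivity)]
    nlinarith
  by_contra! hlt
  have h3 := Real.cos_le_cos_of_nonneg_of_le_pi hy h1 hlt
  rw [Real.cos_abs, mul_comm, Real.cos_sub_int_mul_two_pi] at h3
  linarith

lemma arc_disjoint (n : ℕ) [NeZero n] (u : ℂ) (h h' : ZMod n) (h1 : arc n u h ≠ 0)
    (h2 : arc n u h' ≠ 0) : h = h' := by
  obtain ⟨a, rfl⟩ := ZMod.intCast_surjective h
  obtain ⟨b, rfl⟩ := ZMod.intCast_surjective h'
  rw [arc_ne_zero_iff] at h1 h2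
  have hu : 0 < ‖u‖ := by
    rw [norm_pos_iff]
    rintro rfl
    simp at h1
  have hn : (0 : ℝ) < n := by exact_mod_cast NeZero.pos n
  have hp := Real.pi_pos
  have hpn : 0 ≤ Real.pi / n := by positivity
  rw [← Complex.norm_mul_exp_arg_mul_I u, re_stdAddChar_mul] at h1 h2
  simp only [Complex.norm_mul_exp_arg_mul_I] at h1 h2
  obtain ⟨k, hk⟩ := exists_int_abs_sub_lt_of_cos_lt hpn (lt_of_mul_lt_mul_left h1 hu.le)
  obtain ⟨l, hl⟩ := exists_int_abs_sub_lt_of_cos_lt hpn (lt_of_mul_lt_mul_left h2 hu.le)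
  rw [abs_lt] at hk hl
  have key : (a - b + n * (k - l) : ℤ) = 0 := by
    rw [← Int.abs_lt_one_iff, ← Int.cast_lt (R := ℝ), Int.cast_abs]
    push_cast
    have e : ((a : ℝ) - b + n * (k - l)) * (2 * Real.pi / n) =
        (u.arg - 2 * Real.pi * b / n - 2 * Real.pi * l) -
          (u.arg - 2 * Real.pi * a / n - 2 * Real.pi * k) := by
      field_simp
      ring
    have hpos : 0 < 2 * Real.pi / n := by positivity
    have e2 : 2 * Real.pi / n = Real.pi / n + Real.pi / n := by ring
    rw [abs_lt]
    constructor <;> refine lt_of_mul_lt_mul_right ?_ hpos.le <;> rw [e] <;> linarith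
  have := congrArg (Int.cast : ℤ → ZMod n) key
  push_cast at this
  simpa [sub_eq_zero] using this

lemma exists_arc_ne_zero (n : ℕ) [NeZero n] {u : ℂ} (hu : u ≠ 0) :
    ∃ h, arc n u h ≠ 0 ∨ arc n (Complex.exp ((-(Real.pi / n) : ℝ) * Complex.I) * u) h ≠ 0 := by
  have hu' : 0 < ‖u‖ := norm_pos_iff.mpr hu
  have hn : (0 : ℝ) < n := by exact_mod_cast NeZero.pos n
  have hn1 : (1 : ℝ) ≤ n := by exact_mod_cast NeZero.one_le
  have hp := Real.pi_pos
  have hpn : 0 < Real.pi / n := by positivity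
  have hpn' : Real.pi / n ≤ Real.pi := div_le_self hp.le hn1
  set q := n * u.arg / (2 * Real.pi) with hq
  have ha : u.arg - 2 * Real.pi * ⌊q⌋ / n = (2 * (q - ⌊q⌋)) * (Real.pi / n) := by
    rw [hq]
    field_simp
  have h0 := Int.floor_le q
  have h1 := Int.lt_floor_add_one q
  refine ⟨(⌊q⌋ : ℤ), ?_⟩
  rw [arc_ne_zero_iff, arc_ne_zero_iff, norm_mul, Complex.norm_exp_ofReal_mul_I, one_mul]
  have e : Complex.exp ((-(Real.pi / n) : ℝ) * Complex.I) * u =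
      ‖u‖ * Complex.exp ((u.arg - Real.pi / n : ℝ) * Complex.I) := by
    conv_lhs => rw [← Complex.norm_mul_exp_arg_mul_I u]
    rw [mul_left_comm, ← Complex.exp_add]
    congr 2
    push_cast
    ring
  have e' : ZMod.stdAddChar (-((⌊q⌋ : ℤ) : ZMod n)) * u =
      ZMod.stdAddChar (-((⌊q⌋ : ℤ) : ZMod n)) * (‖u‖ * Complex.exp (u.arg * Complex.I)) := by
    rw [Complex.norm_mul_exp_arg_mul_I]
  rw [e, e', re_stdAddChar_mul, re_stdAddChar_mul]
  rcases lt_or_ge (q - ⌊q⌋) (1 / 2) with hlt | hge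
  · left
    refine mul_lt_mul_of_pos_left (Real.cos_lt_cos_of_nonneg_of_le_pi ?_ hpn' ?_) hu'
    · rw [ha]
      exact mul_nonneg (by linarith) hpn.le
    · rw [ha]
      nlinarith
  · right
    have hb : u.arg - Real.pi / n - 2 * Real.pi * ⌊q⌋ / n =
        (2 * (q - ⌊q⌋) - 1) * (Real.pi / n) := by
      linear_combination ha
    refine mul_lt_mul_of_pos_left (Real.cos_lt_cos_of_nonneg_of_le_pi ?_ hpn' ?_) hu'
    · rw [hb]
      exact mul_nonneg (by linarith) hpn.le
    · rw [hb]
      nlinarith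

/-- The function `[t, g] ↦ t i • φ (g i)` on the join. -/
def Join.coord {G E : Type*} [TopologicalSpace G] [AddCommGroup E] [Module ℝ E] {m : ℕ}
    (φ : G → E) (i : Fin m) : Join G m → E :=
  Quot.lift (fun p => (p.1 : Fin m → ℝ) i • φ (p.2 i)) (by
    rintro ⟨t, g⟩ ⟨t', g'⟩ ⟨h1, h2⟩
    dsimp only at h1 h2 ⊢
    subst h1
    by_cases h : (t : Fin m → ℝ) i = 0
    · simp [h]
    · rw [h2 i h])

lemma Join.continuous_coord {G E : Type*} [TopologicalSpace G] [AddCommGroup E] [Module ℝ E]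
    [TopologicalSpace E] [ContinuousSMul ℝ E] {m : ℕ} {φ : G → E} (hφ : Continuous φ)
    (i : Fin m) : Continuous (Join.coord φ i : Join G m → E) := by
  refine continuous_quot_lift _ ?_
  exact ((continuous_apply i).comp (continuous_subtype_val.comp continuous_fst)).smul
    (hφ.comp ((continuous_apply i).comp continuous_snd))

lemma Join.coord_addAct {G E : Type*} [TopologicalSpace G] [AddGroup G] [AddCommGroup E]
    [Module ℝ E] {m : ℕ} (φ : G → E) (i : Fin m) (ξ : Join G m) (c : G) :
    Join.coord φ i (ξ.addAct c) = Join.coord (fun g => φ (g + c)) i ξ := by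
  induction ξ using Quot.ind
  rfl

lemma Join.coord_addAct_of_mul {G : Type*} [TopologicalSpace G] [AddGroup G] {m : ℕ} {φ : G → ℂ}
    {c : G} {r : ℂ} (h : ∀ g, φ (g + c) = r * φ g) (i : Fin m) (ξ : Join G m) :
    Join.coord φ i (ξ.addAct c) = r * Join.coord φ i ξ := by
  rw [Join.coord_addAct, funext h]
  induction ξ using Quot.ind
  exact (mul_smul_comm _ _ _).symm

/-- The point `[t, g]` of the join. -/
def Join.mk {G : Type*} [TopologicalSpace G] {m : ℕ} (t : stdSimplex ℝ (Fin m)) (g : Fin m → G) :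
    Join G m :=
  Quot.mk _ (t, g)

lemma Join.continuous_mk {G : Type*} [TopologicalSpace G] {m : ℕ} (g : Fin m → G) :
    Continuous fun t => Join.mk t g :=
  continuous_quot_mk.comp (Continuous.prodMk_left g)

/-- A family `a i h` of nonnegative functions, with disjoint supports for fixed `i` and without
common zeros, defines a continuous map to the join of a finite group. -/
lemma exists_continuous_join {X G : Type*} [TopologicalSpace X] [TopologicalSpace G]
    [DiscreteTopology G] [AddGroup G] [Finite G] {m : ℕ} (a : X → Fin m → G → ℝ)
    (hcont : ∀ i h, Continuous fun x => a x i h) (hnonneg : ∀ x i h, 0 ≤ a x i h)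
    (hdisj : ∀ x i h h', a x i h ≠ 0 → a x i h' ≠ 0 → h = h')
    (hne : ∀ x, ∃ i h, a x i h ≠ 0) :
    ∃ ψ : X → Join G m, Continuous ψ ∧
      ∀ x y c, (∀ i h, a y i (h + c) = a x i h) → ψ y = (ψ x).addAct c := by
  classical
  have := Fintype.ofFinite G
  have hT : ∀ x, 0 < ∑ i, ∑ h, a x i h := by
    intro x
    obtain ⟨i, h, hi⟩ := hne x
    refine Finset.sum_pos' (fun i _ => Finset.sum_nonneg fun h _ => hnonneg x i h)
      ⟨i, Finset.mem_univ _, ?_⟩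
    exact Finset.sum_pos' (fun h _ => hnonneg x i h)
      ⟨h, Finset.mem_univ _, (hnonneg x i h).lt_of_ne' hi⟩
  let t : X → stdSimplex ℝ (Fin m) := fun x =>
    ⟨fun i => (∑ h, a x i h) / ∑ i, ∑ h, a x i h,
      fun i => div_nonneg (Finset.sum_nonneg fun h _ => hnonneg x i h) (hT x).le, by
        rw [← Finset.sum_div, div_self (hT x).ne']⟩
  have ht : Continuous t := by
    refine Continuous.subtype_mk (continuous_pi fun i => ?_) _
    refine Continuous.div ?_ ?_ fun x => (hT x).ne'
    · exact continuous_finsetSum _ fun h _ => hcont i h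
    · exact continuous_finsetSum _ fun i _ => continuous_finsetSum _ fun h _ => hcont i h
  let g : X → Fin m → G := fun x i => if h : ∃ h, a x i h ≠ 0 then h.choose else 0
  have hg : ∀ x i h, a x i h ≠ 0 → g x i = h := by
    intro x i h hh
    have hex : ∃ h, a x i h ≠ 0 := ⟨h, hh⟩
    have : g x i = hex.choose := dif_pos hex
    rw [this]
    exact hdisj x i _ _ hex.choose_spec hh
  have htg : ∀ x i, (t x : Fin m → ℝ) i ≠ 0 → a x i (g x i) ≠ 0 := by
    intro x i hi
    have : ∃ h, a x i h ≠ 0 := by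
      by_contra! hall
      exact hi (show (∑ h, a x i h) / _ = 0 by simp [hall])
    obtain ⟨h, hh⟩ := this
    rwa [hg x i h hh]
  refine ⟨fun x => Join.mk (t x) (g x), ?_, ?_⟩
  · rw [continuous_iff_continuousAt]
    intro x₀
    rw [ContinuousAt, tendsto_nhds]
    intro W hW hx₀
    have hφ : ∀ c : Fin m → G, (∀ i, (t x₀ : Fin m → ℝ) i ≠ 0 → c i = g x₀ i) →
        ∀ᶠ x in nhds x₀, Join.mk (t x) c ∈ W := by
      intro c hc
      refine ((Join.continuous_mk c).comp ht).continuousAt.eventually_mem (hW.mem_nhds ?_)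
      have : Join.mk (t x₀) c = Join.mk (t x₀) (g x₀) := Quot.sound ⟨rfl, hc⟩
      rwa [Function.comp_apply, this]
    have hloc : ∀ᶠ x in nhds x₀, ∀ i, (t x₀ : Fin m → ℝ) i ≠ 0 → g x i = g x₀ i := by
      rw [Filter.eventually_all]
      intro i
      by_cases hi : (t x₀ : Fin m → ℝ) i = 0
      · simp [hi]
      · filter_upwards [(hcont i (g x₀ i)).continuousAt.eventually_ne (htg x₀ i hi)] with x hx _
        exact hg x i _ hx
    have hall : ∀ᶠ x in nhds x₀, ∀ c : Fin m → G,
        (∀ i, (t x₀ : Fin m → ℝ) i ≠ 0 → c i = g x₀ i) →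
          Join.mk (t x) c ∈ W := by
      rw [Filter.eventually_all]
      intro c
      by_cases hc : ∀ i, (t x₀ : Fin m → ℝ) i ≠ 0 → c i = g x₀ i
      · filter_upwards [hφ c hc] with x hx _ using hx
      · exact Filter.Eventually.of_forall fun x h => absurd h hc
    filter_upwards [hloc, hall] with x h1 h2 using h2 _ h1
  · intro x y c hxy
    have hsum : ∀ i, ∑ h, a y i h = ∑ h, a x i h := by
      intro i
      rw [← Equiv.sum_comp (Equiv.addRight c)]
      exact Finset.sum_congr rfl fun h _ => hxy i h
    have htt : t y = t x := by
      ext i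
      simp [t, hsum]
    refine Quot.sound ⟨htt, fun i hi => ?_⟩
    apply hg
    dsimp only at hi ⊢
    rw [hxy]
    exact htg x i (htt ▸ hi)

lemma stdAddChar_pow_self (n : ℕ) [NeZero n] (c : ZMod n) : ZMod.stdAddChar c ^ n = 1 := by
  rw [← AddChar.map_nsmul_eq_pow]
  simp

lemma stdAddChar_sq_pow (n : ℕ) [NeZero n] (hd : n ∣ n ^ 2) (c : ZMod (n ^ 2)) :
    ZMod.stdAddChar c ^ n = ZMod.stdAddChar (ZMod.castHom hd (ZMod n) c) := by
  obtain ⟨a, rfl⟩ := ZMod.intCast_surjective c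
  have hn : (n : ℂ) ≠ 0 := by exact_mod_cast NeZero.ne n
  rw [map_intCast (ZMod.castHom hd (ZMod n)), ZMod.stdAddChar_coe, ZMod.stdAddChar_coe, ← Complex.exp_nat_mul]
  congr 1
  push_cast
  field_simp

/-- The number `exp (π i / (2 N))`, whose multiples by `N`-th roots of unity never equal `-1`. -/
def twist (N : ℕ) : ℂ := Complex.exp ((Real.pi / (2 * N) : ℝ) * Complex.I)

lemma twist_pow (N : ℕ) [NeZero N] : twist N ^ N = Complex.I := by
  have hn : (N : ℂ) ≠ 0 := by exact_mod_cast NeZero.ne N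
  rw [twist, ← Complex.exp_nat_mul]
  refine Eq.trans ?_ Complex.exp_pi_div_two_mul_I
  congr 1
  push_cast
  field_simp

lemma twist_combination_eq_zero (N : ℕ) [NeZero N] {s t : ℝ} (hs : 0 ≤ s) (ht : 0 ≤ t)
    (g h : ZMod N) (H : s • ZMod.stdAddChar g + twist N * (t • ZMod.stdAddChar h) = 0) :
    s = 0 ∧ t = 0 := by
  have htw : ‖twist N‖ = 1 := Complex.norm_exp_ofReal_mul_I _
  have H' := eq_neg_of_add_eq_zero_left H
  have hst : s = t := by
    have := congrArg norm H'
    simpa [norm_smul, norm_stdAddChar, htw, abs_of_nonneg hs, abs_of_nonneg ht] using this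
  subst hst
  refine (and_self_iff).mpr ?_
  by_contra hs0
  have hs1 : (s : ℂ) ≠ 0 := by exact_mod_cast hs0
  have h1 : ZMod.stdAddChar g = -(twist N * ZMod.stdAddChar h) := by
    apply mul_left_cancel₀ hs1
    simp only [Complex.real_smul] at H'
    rw [H']
    ring
  have h2 := congrArg (· ^ N) h1
  simp only [neg_pow (twist N * _), mul_pow, stdAddChar_pow_self, twist_pow, mul_one] at h2
  rcases neg_one_pow_eq_or ℂ N with h | h <;> rw [h] at h2 <;>
    simpa using congrArg Complex.im h2

lemma eq_zero_of_no_common_zero {n : ℕ} (hn : 2 ≤ n) {z w v : ℂ} {s : ℝ} (hs : 0 ≤ s)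
    (hv : v ^ n = (s : ℂ) ^ n) (hA : z ^ n + (starRingEnd ℂ w) ^ (n ^ 2 - n) = 0)
    (hB : z * w ^ (n - 1) - v = 0) : z = 0 ∧ w = 0 ∧ v = 0 := by
  have hn0 : n ≠ 0 := by omega
  have hlt : n < n ^ 2 := by nlinarith
  have hd : n ^ 2 - n ≠ 0 := by omega
  have hexp : (n - 1) * n = n ^ 2 - n := by
    rw [Nat.sub_mul, one_mul, sq]
  have hw : w = 0 := by
    have h1 : (s : ℂ) ^ n = -((Complex.normSq w : ℂ) ^ (n ^ 2 - n)) := by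
      rw [← hv, ← sub_eq_zero.mp hB, mul_pow, ← pow_mul, hexp, eq_neg_of_add_eq_zero_left hA,
        Complex.normSq_eq_conj_mul_self, mul_pow]
      ring
    have h2 : s ^ n = -(Complex.normSq w ^ (n ^ 2 - n)) := by exact_mod_cast h1
    have h3 : Complex.normSq w ^ (n ^ 2 - n) = 0 := by
      have := pow_nonneg hs n
      have := pow_nonneg (Complex.normSq_nonneg w) (n ^ 2 - n)
      linarith
    exact Complex.normSq_eq_zero.mp (pow_eq_zero_iff hd |>.mp h3)
  subst hw
  have hz : z = 0 := by simpa [hd, hn0] using hA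
  subst hz
  simpa using hB

/-- The equivariant map from the `(m + 1)`-fold join of `ℤ/n²` to the `m`-fold join of `ℤ/n`. -/
lemma exists_equivariant_join_sq {n m : ℕ} (hn : 2 ≤ n) (hm : 4 ≤ m) (hd : n ∣ n ^ 2) :
    ∃ ψ : Join (ZMod (n ^ 2)) (m + 1) → Join (ZMod n) m, Continuous ψ ∧
      ∀ ξ c, ψ (Join.addAct ξ c) = Join.addAct (ψ ξ) (ZMod.castHom hd (ZMod n) c) := by
  have : NeZero n := ⟨by omega⟩
  set π := ZMod.castHom hd (ZMod n)
  let e : ℕ → Join (ZMod (n ^ 2)) (m + 1) → ℂ := fun i => Join.coord ZMod.stdAddChar (Fin.ofNat (m + 1) i)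
  let z := fun ξ => e 0 ξ + twist (n ^ 2) * e 1 ξ
  let w := fun ξ => e 2 ξ + twist (n ^ 2) * e 3 ξ
  let v : Join (ZMod (n ^ 2)) (m + 1) → ℂ :=
    Join.coord (fun g => ZMod.stdAddChar (π g)) (Fin.ofNat (m + 1) 4)
  let A := fun ξ => z ξ ^ n + (starRingEnd ℂ (w ξ)) ^ (n ^ 2 - n)
  let B := fun ξ => z ξ * w ξ ^ (n - 1) - v ξ
  let κ := Complex.exp ((-(Real.pi / n) : ℝ) * Complex.I)
  let a : Join (ZMod (n ^ 2)) (m + 1) → Fin m → ZMod n → ℝ := fun ξ i h =>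
    if i.val = 0 then arc n (A ξ) h
    else if i.val = 1 then arc n (κ * A ξ) h
    else if i.val = 2 then arc n (B ξ) h
    else if i.val = 3 then arc n (κ * B ξ) h
    else Join.coord (fun g => if π g = h then (1 : ℝ) else 0) i.succ ξ
  have he : ∀ i, Continuous (e i) := fun i => Join.continuous_coord continuous_of_discreteTopology _
  have hz : Continuous z := (he 0).add (continuous_const.mul (he 1))
  have hw : Continuous w := (he 2).add (continuous_const.mul (he 3))
  have hv : Continuous v := Join.continuous_coord continuous_of_discreteTopology _
  have hA : Continuous A := (hz.pow _).add ((Complex.continuous_conj.comp hw).pow _)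
  have hB : Continuous B := (hz.mul (hw.pow _)).sub hv
  have hea : ∀ i ξ c, e i (ξ.addAct c) = ZMod.stdAddChar c * e i ξ := by
    intro i ξ c
    refine Join.coord_addAct_of_mul (fun g => ?_) _ ξ
    rw [AddChar.map_add_eq_mul, mul_comm]
  have hza : ∀ ξ c, z (ξ.addAct c) = ZMod.stdAddChar c * z ξ := by
    intro ξ c
    simp only [z, hea]
    ring
  have hwa : ∀ ξ c, w (ξ.addAct c) = ZMod.stdAddChar c * w ξ := by
    intro ξ c
    simp only [w, hea]
    ring
  have hva : ∀ ξ c, v (ξ.addAct c) = ZMod.stdAddChar (π c) * v ξ := by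
    intro ξ c
    refine Join.coord_addAct_of_mul (fun g => ?_) _ ξ
    rw [map_add, AddChar.map_add_eq_mul, mul_comm]
  have hχ : ∀ c, ZMod.stdAddChar c ^ n = ZMod.stdAddChar (π c) := stdAddChar_sq_pow n hd
  have hle : n ≤ n ^ 2 := Nat.le_self_pow two_ne_zero n
  have hχconj : ∀ c : ZMod (n ^ 2),
      (starRingEnd ℂ (ZMod.stdAddChar c)) ^ (n ^ 2 - n) = ZMod.stdAddChar (π c) := by
    intro c
    have h1 : (starRingEnd ℂ (ZMod.stdAddChar c)) * ZMod.stdAddChar c = 1 := by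
      rw [← Complex.normSq_eq_conj_mul_self, Complex.normSq_eq_norm_sq, norm_stdAddChar]
      simp
    have h2 : (ZMod.stdAddChar c) ^ (n ^ 2 - n) * ZMod.stdAddChar (π c) = 1 := by
      rw [← hχ, ← pow_add, Nat.sub_add_cancel hle, stdAddChar_pow_self]
    calc _ = (starRingEnd ℂ (ZMod.stdAddChar c)) ^ (n ^ 2 - n) *
          ((ZMod.stdAddChar c) ^ (n ^ 2 - n) * ZMod.stdAddChar (π c)) := by rw [h2, mul_one]
      _ = _ := by rw [← mul_assoc, ← mul_pow, h1, one_pow, one_mul]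
  have hAa : ∀ ξ c, A (ξ.addAct c) = ZMod.stdAddChar (π c) * A ξ := by
    intro ξ c
    simp only [A, hza, hwa, map_mul, mul_pow, hχconj, hχ]
    ring
  have hBa : ∀ ξ c, B (ξ.addAct c) = ZMod.stdAddChar (π c) * B ξ := by
    intro ξ c
    simp only [B, hza, hwa, hva, mul_pow, ← hχ]
    have : (ZMod.stdAddChar c : ℂ) ^ n = ZMod.stdAddChar c * ZMod.stdAddChar c ^ (n - 1) :=
      (mul_pow_sub_one (by omega) _).symm
    rw [this]
    ring
  have hcont : ∀ i h, Continuous fun ξ => a ξ i h := by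
    intro i h
    simp only [a]
    split_ifs
    · exact (continuous_arc n h).comp hA
    · exact (continuous_arc n h).comp (continuous_const.mul hA)
    · exact (continuous_arc n h).comp hB
    · exact (continuous_arc n h).comp (continuous_const.mul hB)
    · exact Join.continuous_coord continuous_of_discreteTopology _
  have hnonneg : ∀ ξ i h, 0 ≤ a ξ i h := by
    intro ξ i h
    simp only [a]
    iterate 4 refine ite_nonneg (arc_nonneg _ _ _) ?_
    induction ξ using Quot.ind with | _ p
    exact mul_nonneg (p.1.2.1 _) (ite_nonneg zero_le_one le_rfl)
  have hdisj : ∀ ξ i h h', a ξ i h ≠ 0 → a ξ i h' ≠ 0 → h = h' := by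
    intro ξ i h h'
    simp only [a]
    split_ifs
    iterate 4 exact arc_disjoint n _ h h'
    induction ξ using Quot.ind with | _ p
    intro h1 h2
    simp only [Join.coord, smul_eq_mul, mul_ite, mul_one, mul_zero, ne_eq, ite_eq_right_iff,
      Classical.not_imp] at h1 h2
    exact h1.1.symm.trans h2.1
  have hne : ∀ ξ, ∃ i h, a ξ i h ≠ 0 := by
    intro ξ
    by_contra! H
    have hA0 : A ξ = 0 := by
      by_contra h0
      obtain ⟨h, h1 | h1⟩ := exists_arc_ne_zero n h0
      · exact h1 (by simpa [a] using H ⟨0, by omega⟩ h)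
      · exact h1 (by simpa [a, κ] using H ⟨1, by omega⟩ h)
    have hB0 : B ξ = 0 := by
      by_contra h0
      obtain ⟨h, h1 | h1⟩ := exists_arc_ne_zero n h0
      · exact h1 (by simpa [a] using H ⟨2, by omega⟩ h)
      · exact h1 (by simpa [a, κ] using H ⟨3, by omega⟩ h)
    induction ξ using Quot.ind with | _ p
    obtain ⟨t, g⟩ := p
    have ht0 : ∀ i, 0 ≤ (t : Fin (m + 1) → ℝ) i := t.2.1
    have hvn : v (Quot.mk _ (t, g)) ^ n =
        (((t : Fin (m + 1) → ℝ) (Fin.ofNat (m + 1) 4) : ℝ) : ℂ) ^ n := by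
      simp only [v, Join.coord, Complex.real_smul, mul_pow, stdAddChar_pow_self, mul_one]
    obtain ⟨hz0, hw0, hv0⟩ := eq_zero_of_no_common_zero hn (ht0 _) hvn hA0 hB0
    obtain ⟨t0, t1⟩ := twist_combination_eq_zero (n ^ 2) (ht0 _) (ht0 _) _ _ hz0
    obtain ⟨t2, t3⟩ := twist_combination_eq_zero (n ^ 2) (ht0 _) (ht0 _) _ _ hw0
    have t4 : (t : Fin (m + 1) → ℝ) (Fin.ofNat (m + 1) 4) = 0 := by
      rw [hv0, zero_pow (by omega)] at hvn
      exact_mod_cast pow_eq_zero_iff (by omega) |>.mp hvn.symm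
    have hall : ∀ i, (t : Fin (m + 1) → ℝ) i = 0 := by
      intro i
      have hi : i = Fin.ofNat (m + 1) i.val := by simp
      by_cases h5 : i.val < 5
      · rw [hi]
        generalize i.val = l at h5
        interval_cases l <;> assumption
      · have h := H ⟨i.val - 1, by omega⟩ (π (g i))
        have hs : Fin.succ (⟨i.val - 1, by omega⟩ : Fin m) = i := by
          ext
          simp
          omega
        simp only [a] at h
        rw [if_neg (by omega), if_neg (by omega), if_neg (by omega), if_neg (by omega), hs] at h
        simpa [Join.coord] using h
    have hsum : ∑ i, (t : Fin (m + 1) → ℝ) i = 1 := t.2.2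
    rw [Finset.sum_eq_zero fun i _ => hall i] at hsum
    exact zero_ne_one hsum
  obtain ⟨ψ, hψ, hψa⟩ := exists_continuous_join a hcont hnonneg hdisj hne
  refine ⟨ψ, hψ, fun ξ c => hψa _ _ _ fun i h => ?_⟩
  simp only [a, hAa, hBa, mul_left_comm κ, arc_mul, Join.coord_addAct, map_add, add_left_inj]

lemma exists_equivariant_join_iterate {p k m : ℕ} (hp : 2 ≤ p) (hk : 1 ≤ k) (hm : 4 ≤ m) (j : ℕ)
    {N : ℕ} (hN : N = p ^ (k * 2 ^ j)) (hd : p ^ k ∣ N) :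
    ∃ ψ : Join (ZMod N) (m + j) → Join (ZMod (p ^ k)) m, Continuous ψ ∧
      ∀ ξ c, ψ (Join.addAct ξ c) = Join.addAct (ψ ξ) (ZMod.castHom hd (ZMod (p ^ k)) c) := by
  induction j generalizing N with
  | zero =>
    obtain rfl : N = p ^ k := by simpa using hN
    exact ⟨id, continuous_id, fun ξ c => by simp⟩
  | succ j ih =>
    obtain rfl : N = (p ^ (k * 2 ^ j)) ^ 2 := by rw [hN, ← pow_mul, pow_succ, mul_assoc]
    have hpos : 0 < k * 2 ^ j := by positivity
    have hdj : p ^ k ∣ p ^ (k * 2 ^ j) := pow_dvd_pow p (Nat.le_mul_of_pos_right k (by positivity))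
    have h2 : 2 ≤ p ^ (k * 2 ^ j) := hp.trans (Nat.le_self_pow hpos.ne' p)
    obtain ⟨ψ, hψ, hψa⟩ := ih rfl hdj
    obtain ⟨φ, hφ, hφa⟩ := exists_equivariant_join_sq (m := m + j) h2 (by omega)
      (dvd_pow_self _ two_ne_zero)
    refine ⟨ψ ∘ φ, hψ.comp hφ, fun ξ c => ?_⟩
    rw [Function.comp_apply, hφa, hψa, ← RingHom.comp_apply]
    congr 2
    exact Subsingleton.elim _ _

theorem stmt1 (p k j m : ℕ) (hp : 2 ≤ p) (hk : 1 ≤ k) (hj : 1 ≤ j) (hm : 4 ≤ m) :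
    ∃ ψ : Join (ZMod (p ^ (k * 2 ^ j))) (m + j) → Join (ZMod (p ^ k)) m,
      Continuous ψ ∧
      ∀ (ξ : Join (ZMod (p ^ (k * 2 ^ j))) (m + j)) (c : ZMod (p ^ (k * 2 ^ j))),
        ψ (Join.addAct ξ c) =
          Join.addAct (ψ ξ)
            (ZMod.castHom
              (pow_dvd_pow p
                (by nlinarith [Nat.one_le_two_pow (n := j)] : k ≤ k * 2 ^ j))
              (ZMod (p ^ k)) c) := by
  exact exists_equivariant_join_iterate hp hk hm j rfl _
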